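/- arXiv:2506.00897 — 2 statements merged into one kernel-verified Lean document; each statement's English description precedes it below -/
import Mathlib

section
/- The real vector fields Σ₁ := (1/2)·(Z₊ + Z₋), Σ₂ := (i/2)·(Z₊ − Z₋) (pointwise scalar operations on the maps E → E) and Σ₃ := [Σ₁, Σ₂] (Lie bracket over ℝ) satisfy the su(2) commutation relations: Σ₃(p) = (i/2)·𝓗(p) for all p ∈ E, [Σ₃, Σ₁] = Σ₂ and [Σ₃, Σ₂] = −Σ₁ (brackets over ℝ). -/
open Complex

noncomputable section

/-- `E = ℂ^{k+2}` with coordinates `(w, z₀, z₁, …, z_k)`: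
index `0` is `w` and index `h+1` is `z_h` for `0 ≤ h ≤ k`. -/
abbrev Ec (k : ℕ) := Fin (k + 2) → ℂ

/-- The defining function `F(p) = Re w - 2 ∑_{h=1}^{k} Re (z₀^h conj z_h)`. -/
def Fdef (k : ℕ) (p : Ec k) : ℝ :=
  (p 0).re - 2 * ∑ h : Fin k, ((p 1) ^ ((h : ℕ) + 1) * (starRingEnd ℂ) (p h.succ.succ)).re

/-- The real part of the vector field `X` is tangent to `M = {F = 0}`. -/
def Tangent (k : ℕ) (X : Ec k → Ec k) : Prop :=
  ∀ p : Ec k, Fdef k p = 0 → fderiv ℝ (Fdef k) p (X p) = 0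

/-- The Lie bracket of vector fields over `ℂ`. -/
def lb (k : ℕ) (X Y : Ec k → Ec k) : Ec k → Ec k :=
  fun p => fderiv ℂ Y p (X p) - fderiv ℂ X p (Y p)

/-- The Lie bracket of vector fields over `ℝ`. -/
def lbR (k : ℕ) (X Y : Ec k → Ec k) : Ec k → Ec k :=
  fun p => fderiv ℝ Y p (X p) - fderiv ℝ X p (Y p)

/-- `Z_h = z₀^h ∂_w + (1/2) ∂_{z_h}`. -/
def Zf (k h : ℕ) : Ec k → Ec k := fun p m =>
  if (m : ℕ) = 0 then (p 1) ^ h else if (m : ℕ) = h + 1 then 1 / 2 else 0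

/-- `Z'_h = -i z₀^h ∂_w + (i/2) ∂_{z_h}`. -/
def Zf' (k h : ℕ) : Ec k → Ec k := fun p m =>
  if (m : ℕ) = 0 then -I * (p 1) ^ h else if (m : ℕ) = h + 1 then I / 2 else 0

/-- `W = i ∂_w`. -/
def Wf (k : ℕ) : Ec k → Ec k := fun _ m => if (m : ℕ) = 0 then I else 0

/-- `A_{h,j} = (1/2) z₀^h ∂_{z_j} - (1/2) z₀^j ∂_{z_h}`. -/
def Af (k h j : ℕ) : Ec k → Ec k := fun p m =>
  if (m : ℕ) = j + 1 then (1 / 2) * (p 1) ^ h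
  else if (m : ℕ) = h + 1 then -(1 / 2) * (p 1) ^ j else 0

/-- `A'_{h,j} = -(i/2) z₀^h ∂_{z_j} - (i/2) z₀^j ∂_{z_h}`. -/
def Af' (k h j : ℕ) : Ec k → Ec k := fun p m =>
  if (m : ℕ) = j + 1 then -(I / 2) * (p 1) ^ h
  else if (m : ℕ) = h + 1 then -(I / 2) * (p 1) ^ j else 0

/-- `A'_h = i z₀^h ∂_{z_h}`. -/
def Ahf (k h : ℕ) : Ec k → Ec k := fun p m =>
  if (m : ℕ) = h + 1 then I * (p 1) ^ h else 0

/-- The `W`-family of `(k+1)²` vector fields. -/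
def WFamily (k : ℕ) : Set (Ec k → Ec k) :=
  {X | (∃ h : ℕ, 1 ≤ h ∧ h ≤ k ∧ X = Zf k h) ∨
       (∃ h : ℕ, 1 ≤ h ∧ h ≤ k ∧ X = Zf' k h) ∨
       X = Wf k ∨
       (∃ h j : ℕ, 1 ≤ h ∧ h < j ∧ j ≤ k ∧ X = Af k h j) ∨
       (∃ h j : ℕ, 1 ≤ h ∧ h < j ∧ j ≤ k ∧ X = Af' k h j) ∨
       (∃ h : ℕ, 1 ≤ h ∧ h ≤ k ∧ X = Ahf k h)}

/-- `𝓔 = (k+1) w ∂_w + z₀ ∂_{z_0} + ∑ (k+1-h) z_h ∂_{z_h}`. -/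
def Ef (k : ℕ) : Ec k → Ec k := fun p m =>
  if (m : ℕ) = 0 then ((k : ℂ) + 1) * p m
  else if (m : ℕ) = 1 then p m
  else ((k + 2 - (m : ℕ) : ℕ) : ℂ) * p m

/-- `𝓙 = -i z₀ ∂_{z_0} - i ∑ h z_h ∂_{z_h}`. -/
def Jf (k : ℕ) : Ec k → Ec k := fun p m =>
  if (m : ℕ) = 0 then 0
  else if (m : ℕ) = 1 then -I * p m
  else -I * (((m : ℕ) - 1 : ℕ) : ℂ) * p m

/-- `𝓚 = -z₀ ∂_{z_0} + ∑ h z_h ∂_{z_h}`. -/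
def Kf (k : ℕ) : Ec k → Ec k := fun p m =>
  if (m : ℕ) = 0 then 0
  else if (m : ℕ) = 1 then -p m
  else (((m : ℕ) - 1 : ℕ) : ℂ) * p m

/-- `𝓗 = 2k w ∂_w + 2 z₀ ∂_{z_0} + ∑ 2(k-h) z_h ∂_{z_h}`. -/
def Hf (k : ℕ) : Ec k → Ec k := fun p m =>
  if (m : ℕ) = 0 then 2 * (k : ℂ) * p m
  else if (m : ℕ) = 1 then 2 * p m
  else ((2 * (k + 1 - (m : ℕ)) : ℕ) : ℂ) * p m

/-- `Z₋`. -/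
def Zmf (k : ℕ) : Ec k → Ec k := fun p m =>
  if (m : ℕ) = 0 then 2 * (k : ℂ) * p 2
  else if (m : ℕ) = 1 then (k : ℂ)
  else if hm : (m : ℕ) ≤ k then
    -(k : ℂ) * ((m : ℕ) : ℂ) * p ⟨(m : ℕ) + 1, by omega⟩
  else 0

/-- `Z'₋`. -/
def Zmf' (k : ℕ) : Ec k → Ec k := fun p m =>
  if (m : ℕ) = 0 then -2 * I * (k : ℂ) * p 2
  else if (m : ℕ) = 1 then I * (k : ℂ)
  else if hm : (m : ℕ) ≤ k then
    I * (k : ℂ) * ((m : ℕ) : ℂ) * p ⟨(m : ℕ) + 1, by omega⟩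
  else 0

/-- `Z₊`. -/
def Zpf (k : ℕ) : Ec k → Ec k := fun p m =>
  if (m : ℕ) = 0 then p 1 * p 0
  else if (m : ℕ) = 1 then (p 1) ^ 2 / (k : ℂ)
  else if (m : ℕ) = 2 then p 2 * p 1 - p 0 / 2
  else p m * p 1 +
    (1 - (((m : ℕ) - 2 : ℕ) : ℂ) / (k : ℂ)) * p ⟨(m : ℕ) - 1, by have := m.isLt; omega⟩

/-- `Z'₊`. -/
def Zpf' (k : ℕ) : Ec k → Ec k := fun p m =>
  if (m : ℕ) = 0 then -I * p 1 * p 0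
  else if (m : ℕ) = 1 then -I * (p 1) ^ 2 / (k : ℂ)
  else if (m : ℕ) = 2 then -I * p 2 * p 1 - I / 2 * p 0
  else -I * p m * p 1 +
    I * (1 - (((m : ℕ) - 2 : ℕ) : ℂ) / (k : ℂ)) * p ⟨(m : ℕ) - 1, by have := m.isLt; omega⟩

end

/-- `Σ₁ = (1/2)(Z₊ + Z₋)`. -/
noncomputable def S1 (k : ℕ) : Ec k → Ec k := ((1 : ℂ) / 2) • (Zpf k + Zmf k)
/-- `Σ₂ = (i/2)(Z₊ - Z₋)`. -/
noncomputable def S2 (k : ℕ) : Ec k → Ec k := (I / 2) • (Zpf k - Zmf k)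
/-- `Σ₃ = [Σ₁, Σ₂]` (bracket over `ℝ`). -/
noncomputable def S3 (k : ℕ) : Ec k → Ec k := lbR k (S1 k) (S2 k)

theorem differentiable_Zpf (k : ℕ) : Differentiable ℂ (Zpf k) := by
  refine differentiable_pi.2 fun m => ?_
  unfold Zpf
  split_ifs <;> fun_prop

theorem differentiable_Zmf (k : ℕ) : Differentiable ℂ (Zmf k) := by
  refine differentiable_pi.2 fun m => ?_
  unfold Zmf
  split_ifs <;> fun_prop

theorem differentiable_Hf (k : ℕ) : Differentiable ℂ (Hf k) := by
  refine differentiable_pi.2 fun m => ?_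
  unfold Hf
  split_ifs <;> fun_prop

theorem fderiv_coord {ι : Type*} [Fintype ι] (i : ι) (p v : ι → ℂ) :
    fderiv ℝ (fun q : ι → ℂ => q i) p v = v i :=
  congrArg (· v) (ContinuousLinearMap.proj (R := ℝ) (φ := fun _ : ι => ℂ) i).fderiv

theorem fderiv_component {ι : Type*} [Fintype ι] {X : (ι → ℂ) → ι → ℂ} (hX : Differentiable ℝ X)
    (p v : ι → ℂ) (i : ι) : fderiv ℝ X p v i = fderiv ℝ (fun q => X q i) p v :=
  (congrArg (· v) (fderiv_apply (hX p) i)).symm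

theorem fderiv_real_smul {E : Type*} [NormedAddCommGroup E] [NormedSpace ℂ E] {X : E → E}
    (hX : Differentiable ℂ X) (p v : E) (c : ℂ) :
    fderiv ℝ X p (c • v) = c • fderiv ℝ X p v := by
  rw [(hX p).fderiv_restrictScalars ℝ]
  simp

theorem fderiv_Hf (k : ℕ) (p v : Ec k) : fderiv ℝ (Hf k) p v = Hf k v := by
  ext m
  rw [fderiv_component ((differentiable_Hf k).restrictScalars ℝ)]
  unfold Hf
  split_ifs <;> (rw [fderiv_const_mul (by fun_prop)]; simp [fderiv_coord])

theorem fderiv_Zmf (k : ℕ) (p v : Ec k) (m : Fin (k + 2)) :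
    fderiv ℝ (Zmf k) p v m = if (m : ℕ) = 1 then 0 else Zmf k v m := by
  rw [fderiv_component ((differentiable_Zmf k).restrictScalars ℝ)]
  unfold Zmf
  split_ifs
  · omega
  · rw [fderiv_const_mul (by fun_prop)]; simp [fderiv_coord]
  · simp
  · rw [fderiv_const_mul (by fun_prop)]; simp [fderiv_coord]
  · simp

theorem fderiv_Zpf (k : ℕ) (p v : Ec k) (m : Fin (k + 2)) :
    fderiv ℝ (Zpf k) p v m =
      if (m : ℕ) = 0 then p 1 * v 0 + p 0 * v 1
      else if (m : ℕ) = 1 then 2 * p 1 * v 1 / (k : ℂ)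
      else if (m : ℕ) = 2 then p 2 * v 1 + p 1 * v 2 - v 0 / 2
      else p m * v 1 + p 1 * v m +
        (1 - (((m : ℕ) - 2 : ℕ) : ℂ) / (k : ℂ)) *
          v ⟨(m : ℕ) - 1, by have := m.isLt; omega⟩ := by
  rw [fderiv_component ((differentiable_Zpf k).restrictScalars ℝ)]
  unfold Zpf
  simp only [div_eq_mul_inv]
  split_ifs
  · rw [fderiv_fun_mul (by fun_prop) (by fun_prop)]; simp [fderiv_coord]
  · rw [fderiv_mul_const (by fun_prop), fderiv_fun_pow _ (by fun_prop)]; simp [fderiv_coord]; ring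
  · rw [fderiv_fun_sub (by fun_prop) (by fun_prop), fderiv_fun_mul (by fun_prop) (by fun_prop),
      fderiv_mul_const (by fun_prop)]
    simp [fderiv_coord]; ring
  · rw [fderiv_fun_add (by fun_prop) (by fun_prop), fderiv_fun_mul (by fun_prop) (by fun_prop),
      fderiv_const_mul (by fun_prop)]
    simp [fderiv_coord]

theorem lbR_Zmf_Zpf (k : ℕ) (hk : 1 ≤ k) : lbR k (Zmf k) (Zpf k) = Hf k := by
  obtain ⟨n, rfl⟩ : ∃ n, k = n + 1 := ⟨k - 1, by omega⟩
  have h2 (h : 2 < n + 1 + 2) : (⟨2, h⟩ : Fin (n + 1 + 2)) = 2 := rfl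
  have hk0 : (n : ℂ) + 1 ≠ 0 := by exact_mod_cast n.succ_ne_zero
  ext p ⟨m, hm⟩
  simp only [lbR, Pi.sub_apply, fderiv_Zmf, fderiv_Zpf]
  rcases m with _ | _ | _ | m
  · simp [-Fin.coe_ofNat_eq_mod, Zmf, Zpf, Hf]
    ring
  · simp [-Fin.coe_ofNat_eq_mod, Zmf, Hf]
    field_simp
  · rcases n with _ | n
    · simp [-Fin.coe_ofNat_eq_mod, Zmf, Hf, h2]
    · simp [-Fin.coe_ofNat_eq_mod, Zmf, Zpf, Hf, h2]
      push_cast at hk0 ⊢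
      field_simp
      ring
  · obtain ⟨d, rfl⟩ : ∃ d, n = m + 1 + d := ⟨n - (m + 1), by omega⟩
    rcases d with _ | d
    · have hm0 : (m : ℂ) + 1 + 1 ≠ 0 := by exact_mod_cast (m + 1).succ_ne_zero
      simp [-Fin.coe_ofNat_eq_mod, Zmf, Hf]
      field_simp
      ring
    · simp [-Fin.coe_ofNat_eq_mod, Zmf, Zpf, Hf]
      push_cast at hk0 ⊢
      field_simp
      ring

theorem lbR_Hf_Zpf (k : ℕ) (hk : 1 ≤ k) : lbR k (Hf k) (Zpf k) = (2 : ℂ) • Zpf k := by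
  obtain ⟨n, rfl⟩ : ∃ n, k = n + 1 := ⟨k - 1, by omega⟩
  ext p ⟨m, hm⟩
  simp only [lbR, Pi.sub_apply, Pi.smul_apply, smul_eq_mul, fderiv_Hf, fderiv_Zpf]
  rcases m with _ | _ | _ | m
  · simp [-Fin.coe_ofNat_eq_mod, Zpf, Hf]
    ring
  · simp [-Fin.coe_ofNat_eq_mod, Zpf, Hf]
    field_simp
    ring
  · simp [-Fin.coe_ofNat_eq_mod, Zpf, Hf]
    ring
  · obtain ⟨d, rfl⟩ : ∃ d, n = m + 1 + d := ⟨n - (m + 1), by omega⟩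
    have e : m + 1 + d + 1 + 1 - (m + 1 + 1 + 1) = d := by omega
    have e' : m + 1 + d + 1 + 1 - (m + 1 + 1) = d + 1 := by omega
    simp [-Fin.coe_ofNat_eq_mod, Zpf, Hf, e, e']
    ring

theorem lbR_Hf_Zmf (k : ℕ) (hk : 1 ≤ k) : lbR k (Hf k) (Zmf k) = (-2 : ℂ) • Zmf k := by
  obtain ⟨n, rfl⟩ : ∃ n, k = n + 1 := ⟨k - 1, by omega⟩
  ext p ⟨m, hm⟩
  simp only [lbR, Pi.sub_apply, Pi.smul_apply, smul_eq_mul, fderiv_Hf, fderiv_Zmf]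
  rcases m with _ | _ | _ | m
  · simp [-Fin.coe_ofNat_eq_mod, Zmf, Hf]
    ring
  · simp [-Fin.coe_ofNat_eq_mod, Zmf, Hf]
  · rcases n with _ | n
    · simp [-Fin.coe_ofNat_eq_mod, Zmf, Hf]
    · simp [-Fin.coe_ofNat_eq_mod, Zmf, Hf]
      ring
  · obtain ⟨d, rfl⟩ : ∃ d, n = m + 1 + d := ⟨n - (m + 1), by omega⟩
    rcases d with _ | d
    · simp [-Fin.coe_ofNat_eq_mod, Zmf, Hf]
    · have e : m + 1 + (d + 1) + 1 + 1 - (m + 1 + 1 + 1) = d + 1 := by omega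
      have e' : m + 1 + (d + 1) + 1 + 1 - (m + 1 + 1 + 1 + 1) = d := by omega
      simp [-Fin.coe_ofNat_eq_mod, Zmf, Hf, e, e']
      ring

theorem fderiv_S1 (k : ℕ) (p v : Ec k) :
    fderiv ℝ (S1 k) p v =
      ((1 : ℂ) / 2) • (fderiv ℝ (Zpf k) p v + fderiv ℝ (Zmf k) p v) := by
  have hp := (differentiable_Zpf k p).restrictScalars ℝ
  have hm := (differentiable_Zmf k p).restrictScalars ℝ
  rw [S1, fderiv_const_smul (hp.add hm), fderiv_add hp hm]
  rfl

theorem fderiv_S2 (k : ℕ) (p v : Ec k) :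
    fderiv ℝ (S2 k) p v = (I / 2) • (fderiv ℝ (Zpf k) p v - fderiv ℝ (Zmf k) p v) := by
  have hp := (differentiable_Zpf k p).restrictScalars ℝ
  have hm := (differentiable_Zmf k p).restrictScalars ℝ
  rw [S2, fderiv_const_smul (hp.sub hm), fderiv_sub hp hm]
  rfl

/-- `Σ₁, Σ₂, Σ₃` satisfy the `su(2)` commutation relations, with `Σ₃ = (i/2)𝓗`. -/
theorem stmt18 (k : ℕ) (hk : 1 ≤ k) :
    (∀ p : Ec k, S3 k p = (I / 2) • Hf k p) ∧
    lbR k (S3 k) (S1 k) = S2 k ∧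
    lbR k (S3 k) (S2 k) = -S1 k := by
  have dp := fderiv_real_smul (differentiable_Zpf k)
  have dm := fderiv_real_smul (differentiable_Zmf k)
  have dh := fderiv_real_smul (differentiable_Hf k)
  have h₃ : S3 k = (I / 2) • Hf k := by
    rw [← lbR_Zmf_Zpf k hk]
    ext p m
    simp only [S3, lbR, fderiv_S1, fderiv_S2]
    simp only [lbR, S1, S2, Pi.smul_apply, Pi.add_apply, Pi.sub_apply,
      smul_eq_mul, dp, dm, map_add, map_sub]
    ring
  have hfd (p v : Ec k) : fderiv ℝ (S3 k) p v = (I / 2) • fderiv ℝ (Hf k) p v := by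
    rw [h₃, fderiv_const_smul ((differentiable_Hf k p).restrictScalars ℝ)]
    rfl
  refine ⟨fun p => by rw [h₃]; rfl, ?_, ?_⟩ <;> ext p m <;>
    have hp := congrFun (congrFun (lbR_Hf_Zpf k hk) p) m <;>
    have hm := congrFun (congrFun (lbR_Hf_Zmf k hk) p) m <;>
    simp only [lbR, Pi.smul_apply, Pi.sub_apply, smul_eq_mul] at hp hm <;>
    simp only [lbR, hfd, fderiv_S1, fderiv_S2] <;>
    simp only [h₃, S1, S2, Pi.smul_apply, Pi.add_apply, Pi.sub_apply,
      Pi.neg_apply, smul_eq_mul, dp, dm, dh, map_add, map_sub]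
  · linear_combination (I / 4) * hp + (I / 4) * hm
  · linear_combination (I ^ 2 / 4) * hp - (I ^ 2 / 4) * hm +
      (1 / 2) * (Zpf k p m + Zmf k p m) * I_sq
end

section
/- The following bracket identities, used to identify the (2k+1)-dimensional irreducible sl₂-representation inside the vector fields on E, hold: [Z₋, W] = 0, [Z'₋, W] = 0, [Z₊, A'_k] = 0, [Z'₊, A'_k] = 0; moreover, defining iterated brackets W_0 := W and W_{j+1} := [Z₊, W_j], one has [𝓗, W_j] = 2(j − k)·W_j for every j ≥ 0 (all brackets over ℂ). -/
open Complex

/-- The iterated brackets `W_0 = W`, `W_{j+1} = [Z₊, W_j]`. -/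
noncomputable def Wseq (k : ℕ) : ℕ → (Ec k → Ec k)
  | 0 => Wf k
  | (j + 1) => lb k (Zpf k) (Wseq k j)

lemma fderiv_coord_s19 {k : ℕ} (i : Fin (k + 2)) (p : Ec k) :
    fderiv ℂ (fun q : Ec k => q i) p = ContinuousLinearMap.proj i :=
  (ContinuousLinearMap.proj (R := ℂ) (φ := fun _ : Fin (k + 2) => ℂ) i).hasFDerivAt.fderiv

lemma lb_apply {k : ℕ} {X Y : Ec k → Ec k} (hX : Differentiable ℂ X) (hY : Differentiable ℂ Y)
    (p : Ec k) (m : Fin (k + 2)) :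
    lb k X Y p m = fderiv ℂ (fun q => Y q m) p (X p) - fderiv ℂ (fun q => X q m) p (Y p) := by
  rw [fderiv_apply (hY p), fderiv_apply (hX p)]
  rfl

lemma contDiff_Zpf (k : ℕ) : ContDiff ℂ ⊤ (Zpf k) := by
  refine contDiff_pi.2 fun m => ?_
  unfold Zpf
  split_ifs <;> fun_prop

lemma contDiff_Zpf' (k : ℕ) : ContDiff ℂ ⊤ (Zpf' k) := by
  refine contDiff_pi.2 fun m => ?_
  unfold Zpf'
  split_ifs <;> fun_prop

lemma contDiff_Zmf (k : ℕ) : ContDiff ℂ ⊤ (Zmf k) := by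
  refine contDiff_pi.2 fun m => ?_
  unfold Zmf
  split_ifs <;> fun_prop

lemma contDiff_Zmf' (k : ℕ) : ContDiff ℂ ⊤ (Zmf' k) := by
  refine contDiff_pi.2 fun m => ?_
  unfold Zmf'
  split_ifs <;> fun_prop

lemma contDiff_Hf (k : ℕ) : ContDiff ℂ ⊤ (Hf k) := by
  refine contDiff_pi.2 fun m => ?_
  unfold Hf
  split_ifs <;> fun_prop

lemma contDiff_Ahf (k h : ℕ) : ContDiff ℂ ⊤ (Ahf k h) := by
  refine contDiff_pi.2 fun m => ?_
  unfold Ahf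
  split_ifs <;> fun_prop

lemma contDiff_Wf (k : ℕ) : ContDiff ℂ ⊤ (Wf k) := contDiff_const

lemma contDiff_Wseq (k j : ℕ) : ContDiff ℂ ⊤ (Wseq k j) := by
  induction j with
  | zero => exact contDiff_Wf k
  | succ j ih => exact (contDiff_Zpf k).lieBracket_vectorField ih le_top

lemma val_two {k : ℕ} (hk : 1 ≤ k) : ((2 : Fin (k + 2)) : ℕ) = 2 :=
  Nat.mod_eq_of_lt (a := 2) (by omega)

lemma fderiv_Zpf_apply (k : ℕ) (p v : Ec k) (m : Fin (k + 2)) :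
    fderiv ℂ (fun q => Zpf k q m) p v =
      if (m : ℕ) = 0 then p 1 * v 0 + p 0 * v 1
      else if (m : ℕ) = 1 then 2 * p 1 * v 1 / (k : ℂ)
      else if (m : ℕ) = 2 then p 2 * v 1 + p 1 * v 2 - v 0 / 2
      else p m * v 1 + p 1 * v m + (1 - (((m : ℕ) - 2 : ℕ) : ℂ) / (k : ℂ)) *
        v ⟨(m : ℕ) - 1, by have := m.isLt; omega⟩ := by
  unfold Zpf
  split_ifs with h0 h1 h2
  · simp [fderiv_fun_mul, fderiv_coord_s19, differentiableAt_apply]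
  · simp only [div_eq_mul_inv]
    simp [fderiv_fun_mul, fderiv_fun_pow, fderiv_coord_s19, differentiableAt_apply]
    ring
  · simp only [div_eq_mul_inv]
    rw [fderiv_fun_sub (by fun_prop) (by fun_prop)]
    simp [fderiv_fun_mul, fderiv_coord_s19, differentiableAt_apply]
    ring
  · rw [fderiv_fun_add (by fun_prop) (by fun_prop)]
    simp [fderiv_fun_mul, fderiv_coord_s19, differentiableAt_apply]

lemma fderiv_Zpf'_apply (k : ℕ) (p v : Ec k) (m : Fin (k + 2)) :
    fderiv ℂ (fun q => Zpf' k q m) p v =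
      if (m : ℕ) = 0 then -I * (p 1 * v 0 + p 0 * v 1)
      else if (m : ℕ) = 1 then -I * (2 * p 1 * v 1) / (k : ℂ)
      else if (m : ℕ) = 2 then -I * (p 2 * v 1 + p 1 * v 2) - I / 2 * v 0
      else -I * (p m * v 1 + p 1 * v m) + I * (1 - (((m : ℕ) - 2 : ℕ) : ℂ) / (k : ℂ)) *
        v ⟨(m : ℕ) - 1, by have := m.isLt; omega⟩ := by
  unfold Zpf'
  split_ifs with h0 h1 h2
  · simp [fderiv_fun_mul, fderiv_coord_s19, differentiableAt_apply]
    ring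
  · simp only [div_eq_mul_inv]
    rw [fderiv_mul_const (by fun_prop), fderiv_const_mul (by fun_prop)]
    simp [fderiv_fun_pow, fderiv_coord_s19, differentiableAt_apply]
    ring
  · rw [fderiv_fun_sub (by fun_prop) (by fun_prop)]
    simp [fderiv_fun_mul, fderiv_coord_s19, differentiableAt_apply]
    ring
  · rw [fderiv_fun_add (by fun_prop) (by fun_prop)]
    simp [fderiv_fun_mul, fderiv_coord_s19, differentiableAt_apply]
    ring

lemma fderiv_Hf_apply (k : ℕ) (p v : Ec k) (m : Fin (k + 2)) :
    fderiv ℂ (fun q => Hf k q m) p v = Hf k v m := by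
  unfold Hf
  split_ifs <;> simp [fderiv_const_mul, fderiv_coord_s19, differentiableAt_apply]

lemma fderiv_Ahf_apply (k h : ℕ) (p v : Ec k) (m : Fin (k + 2)) :
    fderiv ℂ (fun q => Ahf k h q m) p v =
      if (m : ℕ) = h + 1 then I * (h * p 1 ^ (h - 1) * v 1) else 0 := by
  unfold Ahf
  split_ifs <;> simp [fderiv_const_mul, fderiv_fun_pow, fderiv_coord_s19, differentiableAt_apply]

lemma Wf_apply_of_ne {k : ℕ} (p : Ec k) {m : Fin (k + 2)} (hm : (m : ℕ) ≠ 0) : Wf k p m = 0 :=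
  if_neg hm

lemma lb_Wf_apply {k : ℕ} {X : Ec k → Ec k} (hX : Differentiable ℂ X) (p : Ec k)
    (m : Fin (k + 2)) : lb k X (Wf k) p m = -fderiv ℂ (fun q => X q m) p (Wf k p) := by
  rw [lb_apply hX ((contDiff_Wf k).differentiable (by simp))]
  simp [Wf]

lemma lb_Zmf_Wf {k : ℕ} (hk : 1 ≤ k) : lb k (Zmf k) (Wf k) = 0 := by
  funext p m
  rw [lb_Wf_apply ((contDiff_Zmf k).differentiable (by simp))]
  unfold Zmf
  have hW : Wf k p 2 = 0 := if_neg (by rw [val_two hk]; decide)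
  split_ifs <;>
    simp [fderiv_const_mul, fderiv_coord_s19, differentiableAt_apply, hW, Wf_apply_of_ne]

lemma lb_Zmf'_Wf {k : ℕ} (hk : 1 ≤ k) : lb k (Zmf' k) (Wf k) = 0 := by
  funext p m
  rw [lb_Wf_apply ((contDiff_Zmf' k).differentiable (by simp))]
  unfold Zmf'
  have hW : Wf k p 2 = 0 := if_neg (by rw [val_two hk]; decide)
  split_ifs <;>
    simp [fderiv_const_mul, fderiv_coord_s19, differentiableAt_apply, hW, Wf_apply_of_ne]

lemma Ahf_apply_of_ne {k h : ℕ} (p : Ec k) {m : Fin (k + 2)} (hm : (m : ℕ) ≠ h + 1) :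
    Ahf k h p m = 0 :=
  if_neg hm

lemma fderiv_Zpf_apply_Ahf {k : ℕ} (hk : 1 ≤ k) (p : Ec k) (m : Fin (k + 2)) :
    fderiv ℂ (fun q => Zpf k q m) p (Ahf k k p) = p 1 * Ahf k k p m := by
  have hm := m.isLt
  have h0 : Ahf k k p 0 = 0 := Ahf_apply_of_ne p (by simp)
  have h1 : Ahf k k p 1 = 0 := Ahf_apply_of_ne p (by rw [Fin.val_one]; omega)
  rw [fderiv_Zpf_apply]
  split_ifs with hm0 hm1 hm2
  · rw [show m = 0 from Fin.ext hm0, h0, h1]; ring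
  · rw [show m = 1 from Fin.ext hm1, h1]; ring
  · rw [show m = 2 from Fin.ext (hm2.trans (val_two hk).symm), h0, h1]; ring
  · rw [h1, Ahf_apply_of_ne p (m := ⟨(m : ℕ) - 1, _⟩) (by dsimp only; omega)]; ring

lemma fderiv_Zpf'_apply_Ahf {k : ℕ} (hk : 1 ≤ k) (p : Ec k) (m : Fin (k + 2)) :
    fderiv ℂ (fun q => Zpf' k q m) p (Ahf k k p) = -I * p 1 * Ahf k k p m := by
  have hm := m.isLt
  have h0 : Ahf k k p 0 = 0 := Ahf_apply_of_ne p (by simp)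
  have h1 : Ahf k k p 1 = 0 := Ahf_apply_of_ne p (by rw [Fin.val_one]; omega)
  rw [fderiv_Zpf'_apply]
  split_ifs with hm0 hm1 hm2
  · rw [show m = 0 from Fin.ext hm0, h0, h1]; ring
  · rw [show m = 1 from Fin.ext hm1, h1]; ring
  · rw [show m = 2 from Fin.ext (hm2.trans (val_two hk).symm), h0, h1]; ring
  · rw [h1, Ahf_apply_of_ne p (m := ⟨(m : ℕ) - 1, _⟩) (by dsimp only; omega)]; ring

lemma lb_Zpf_Ahf {k : ℕ} (hk : 1 ≤ k) : lb k (Zpf k) (Ahf k k) = 0 := by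
  funext p m
  have hZ : Zpf k p 1 = p 1 ^ 2 / (k : ℂ) := by simp [Zpf]
  rw [lb_apply ((contDiff_Zpf _).differentiable (by simp))
    ((contDiff_Ahf _ _).differentiable (by simp)), fderiv_Ahf_apply, fderiv_Zpf_apply_Ahf hk, hZ,
    Pi.zero_apply, Pi.zero_apply]
  unfold Ahf
  split_ifs
  · obtain ⟨n, rfl⟩ := Nat.exists_eq_add_of_le' hk
    have hk0 : ((n + 1 : ℕ) : ℂ) ≠ 0 := Nat.cast_ne_zero.2 n.succ_ne_zero
    rw [Nat.add_sub_cancel]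
    field_simp
    ring
  · simp

lemma lb_Zpf'_Ahf {k : ℕ} (hk : 1 ≤ k) : lb k (Zpf' k) (Ahf k k) = 0 := by
  funext p m
  have hZ : Zpf' k p 1 = -I * p 1 ^ 2 / (k : ℂ) := by simp [Zpf']
  rw [lb_apply ((contDiff_Zpf' _).differentiable (by simp))
    ((contDiff_Ahf _ _).differentiable (by simp)), fderiv_Ahf_apply, fderiv_Zpf'_apply_Ahf hk, hZ,
    Pi.zero_apply, Pi.zero_apply]
  unfold Ahf
  split_ifs
  · obtain ⟨n, rfl⟩ := Nat.exists_eq_add_of_le' hk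
    have hk0 : ((n + 1 : ℕ) : ℂ) ≠ 0 := Nat.cast_ne_zero.2 n.succ_ne_zero
    rw [Nat.add_sub_cancel]
    field_simp
    ring
  · simp

lemma Hf_apply_zero (k : ℕ) (p : Ec k) : Hf k p 0 = 2 * (k : ℂ) * p 0 := by
  simp [Hf]

lemma Hf_apply_one (k : ℕ) (p : Ec k) : Hf k p 1 = 2 * p 1 := by
  simp [Hf]

lemma Hf_apply_of_two_le {k : ℕ} (p : Ec k) {m : Fin (k + 2)} (hm : 2 ≤ (m : ℕ)) :
    Hf k p m = 2 * ((k : ℂ) + 1 - (m : ℕ)) * p m := by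
  have := m.isLt
  rw [Hf, if_neg (by omega), if_neg (by omega)]
  push_cast [Nat.cast_sub (show (m : ℕ) ≤ k + 1 by omega)]
  ring

lemma lb_Hf_Zpf {k : ℕ} (hk : 1 ≤ k) : lb k (Hf k) (Zpf k) = (2 : ℂ) • Zpf k := by
  funext p m
  rw [lb_apply ((contDiff_Hf _).differentiable (by simp))
    ((contDiff_Zpf _).differentiable (by simp)), fderiv_Hf_apply, fderiv_Zpf_apply,
    Pi.smul_apply, Pi.smul_apply, smul_eq_mul]
  split_ifs with hm0 hm1 hm2
  · rw [show m = 0 from Fin.ext hm0]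
    simp only [Hf_apply_zero, Hf_apply_one]
    simp only [Zpf, Fin.val_zero, if_true]
    ring
  · rw [show m = 1 from Fin.ext hm1]
    simp only [Hf_apply_one]
    simp only [Zpf, Fin.val_one, one_ne_zero, if_true, if_false]
    ring
  · rw [show m = 2 from Fin.ext (hm2.trans (val_two hk).symm)]
    have h2 := val_two hk
    rw [Hf_apply_zero, Hf_apply_one, Hf_apply_of_two_le _ h2.ge, Hf_apply_of_two_le _ h2.ge,
      show Zpf k p 2 = p 2 * p 1 - p 0 / 2 by simp only [Zpf, h2]; norm_num, h2]
    push_cast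
    ring
  · have hprev : Hf k p ⟨(m : ℕ) - 1, by have := m.isLt; omega⟩ =
        2 * ((k : ℂ) + 2 - (m : ℕ)) * p ⟨(m : ℕ) - 1, by have := m.isLt; omega⟩ := by
      rw [Hf_apply_of_two_le _ (by dsimp only; omega)]
      push_cast [Nat.cast_sub (show 1 ≤ (m : ℕ) by omega)]
      ring
    rw [Hf_apply_one, Hf_apply_of_two_le _ (show 2 ≤ (m : ℕ) by omega),
      Hf_apply_of_two_le _ (show 2 ≤ (m : ℕ) by omega), hprev, Zpf, if_neg hm0, if_neg hm1,
      if_neg hm2]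
    ring

lemma lb_Hf_Wf (k : ℕ) : lb k (Hf k) (Wf k) = (-2 * (k : ℂ)) • Wf k := by
  funext p m
  rw [lb_Wf_apply ((contDiff_Hf k).differentiable (by simp)), fderiv_Hf_apply]
  by_cases h : m = 0 <;> simp [Hf, Wf, h]

lemma lb_Hf_Wseq {k : ℕ} (hk : 1 ≤ k) (j : ℕ) :
    lb k (Hf k) (Wseq k j) = (2 * ((j : ℂ) - (k : ℂ))) • Wseq k j := by
  induction j with
  | zero => simpa [Wseq] using lb_Hf_Wf k
  | succ j ih =>
    funext p
    have hJ := VectorField.leibniz_identity_lieBracket (n := ⊤) (x := p) le_top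
      (contDiff_Hf k).contDiffAt (contDiff_Zpf k).contDiffAt (contDiff_Wseq k j).contDiffAt
    change lb k (Hf k) (lb k (Zpf k) (Wseq k j)) p =
      lb k (lb k (Hf k) (Zpf k)) (Wseq k j) p + lb k (Zpf k) (lb k (Hf k) (Wseq k j)) p at hJ
    rw [lb_Hf_Zpf hk, ih] at hJ
    have hl : lb k ((2 : ℂ) • Zpf k) (Wseq k j) p = (2 : ℂ) • lb k (Zpf k) (Wseq k j) p :=
      VectorField.lieBracket_const_smul_left ((contDiff_Zpf k).differentiable (by simp) p)
    have hr (c : ℂ) : lb k (Zpf k) (c • Wseq k j) p = c • lb k (Zpf k) (Wseq k j) p :=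
      VectorField.lieBracket_const_smul_right ((contDiff_Wseq k j).differentiable (by simp) p)
    rw [hl, hr, ← add_smul] at hJ
    refine hJ.trans ?_
    rw [Pi.smul_apply, Nat.cast_succ, Wseq]
    congr 1
    ring

/-- Bracket identities identifying the `(2k+1)`-dimensional irreducible `sl₂`-representation
inside the vector fields on `E`. -/
theorem stmt19 (k : ℕ) (hk : 1 ≤ k) :
    lb k (Zmf k) (Wf k) = 0 ∧ lb k (Zmf' k) (Wf k) = 0 ∧
    lb k (Zpf k) (Ahf k k) = 0 ∧ lb k (Zpf' k) (Ahf k k) = 0 ∧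
    (∀ j : ℕ, lb k (Hf k) (Wseq k j) = (2 * ((j : ℂ) - (k : ℂ))) • Wseq k j) := by
  exact ⟨lb_Zmf_Wf hk, lb_Zmf'_Wf hk, lb_Zpf_Ahf hk, lb_Zpf'_Ahf hk, lb_Hf_Wseq hk⟩
end
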